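/- Let B ⊴ H be a normal subgroup of a countable group H such that the centralizer C_H(B) has finite index in H. Then [B : Z(B)] < ∞. Moreover, there is a set C of representatives for B/Z(B) and a sequence of finite subsets B_n = A_n C ⊆ B with A_n ⊆ Z(B), such that (B_n) is a Følner sequence for B and lim_{n→∞} |g B_n g^{-1} △ B_n| / |B_n| = 0 for every g ∈ H. -/

import Mathlib

open Filter Pointwise

open Classical in
lemma growth_aux {Z : Type*} [CommGroup Z] (S : Finset Z) (k : ℕ) :
    (S ^ k).card ≤ (k + 1) ^ S.card := by
  have h : S ^ k ⊆ (Finset.univ : Finset (S → Fin (k+1))).image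
      (fun f => ∏ s : S, (s : Z) ^ (f s : ℕ)) := by
    intro x hx
    rw [Finset.mem_pow] at hx
    obtain ⟨f, rfl⟩ := hx
    rw [Finset.mem_image]
    refine ⟨fun s => ⟨(Finset.univ.filter (fun i => f i = s)).card, ?_⟩, Finset.mem_univ _, ?_⟩
    · have := Finset.card_le_univ (Finset.univ.filter (fun i : Fin k => f i = s))
      simp only [Fintype.card_fin] at this
      omega
    · rw [List.prod_ofFn, ← Finset.prod_fiberwise (s := Finset.univ) (g := f)]
      refine Finset.prod_congr rfl fun s _ => ?_
      rw [Finset.prod_congr rfl (g := fun _ => (s : Z))]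
      · simp
      · intro i hi
        simp only [Finset.mem_filter] at hi
        rw [hi.2]
  refine (Finset.card_le_card h).trans (Finset.card_image_le.trans ?_)
  simp

open Classical in
lemma growth_small {Z : Type*} [CommGroup Z] (S : Finset Z) (hS : S.Nonempty) (ε : ℝ) (hε : 0 < ε) :
    ∃ k : ℕ, ((S ^ (k+1)).card : ℝ) ≤ (1 + ε) * (S ^ k).card := by
  by_contra! hcon
  have h1 : ∀ k : ℕ, (1 + ε) ^ k ≤ ((S ^ k).card : ℝ) := by
    intro k
    induction k with
    | zero => simp
    | succ k ih =>
      rw [pow_succ']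
      exact (mul_le_mul_of_nonneg_left ih (by positivity)).trans (hcon k).le
  have h2 := tendsto_pow_const_div_const_pow_of_one_lt S.card (r := 1 + ε) (by linarith)
  have h3 := (h2.comp (tendsto_add_atTop_nat 1)).eventually
    (gt_mem_nhds (show (0:ℝ) < 1 / (1 + ε) by positivity))
  obtain ⟨k, hk⟩ := h3.exists
  simp only [Function.comp] at hk
  have h4 : (1 + ε) ^ k ≤ ((k + 1 : ℕ) : ℝ) ^ S.card :=
    (h1 k).trans (by exact_mod_cast growth_aux S k)
  rw [div_lt_div_iff₀ (by positivity) (by positivity), pow_succ] at hk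
  nlinarith

open Classical in
lemma folner_aux {Z : Type*} [CommGroup Z] [Countable Z] (Q : Subgroup (MulAut Z))
    (hQ : (Q : Set (MulAut Z)).Finite) :
    ∃ A P : ℕ → Finset Z, (∀ n, (A n).Nonempty) ∧ (∀ n, A n ⊆ P n) ∧
      (∀ n, ∀ σ ∈ Q, ∀ a ∈ A n, σ a ∈ A n) ∧
      (∀ z, ∀ᶠ n in atTop, ∀ a ∈ A n, z * a ∈ P n) ∧
      (∀ n : ℕ, ((P n).card : ℝ) ≤ (1 + 1 / ((n : ℝ) + 1)) * (A n).card) := by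
  obtain ⟨e, he⟩ := exists_surjective_nat Z
  let S : ℕ → Finset Z := fun n => insert 1
    ((Finset.range (n+1) ×ˢ hQ.toFinset).image (fun p => p.2 (e p.1)))
  have h1 : ∀ n, 1 ∈ S n := fun n => Finset.mem_insert_self _ _
  have hS : ∀ n, ∀ σ ∈ Q, (S n).image σ ⊆ S n := by
    intro n σ hσ x hx
    simp only [S, Finset.mem_image, Finset.mem_insert, Finset.mem_product, Prod.exists,
      Set.Finite.mem_toFinset, SetLike.mem_coe] at hx ⊢
    obtain ⟨y, (rfl | ⟨i, τ, ⟨hi, hτ⟩, rfl⟩), rfl⟩ := hx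
    · left; simp
    · right; exact ⟨i, σ * τ, ⟨hi, Q.mul_mem hσ hτ⟩, rfl⟩
  choose k hk using fun n : ℕ => growth_small (S n) ⟨1, h1 n⟩ (1 / ((n:ℝ)+1)) (by positivity)
  refine ⟨fun n => S n ^ k n, fun n => S n ^ (k n + 1), ?_, ?_, ?_, ?_, hk⟩
  · intro n; exact Finset.Nonempty.pow ⟨1, h1 n⟩
  · intro n; exact Finset.pow_subset_pow_right (h1 n) (Nat.le_succ _)
  · intro n σ hσ a ha
    have h2 : (S n ^ k n).image σ ⊆ S n ^ k n := by
      rw [Finset.image_pow]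
      exact Finset.pow_subset_pow_left (hS n σ hσ)
    exact h2 (Finset.mem_image_of_mem _ ha)
  · intro z
    obtain ⟨i, rfl⟩ := he z
    filter_upwards [eventually_ge_atTop i] with n hn a ha
    rw [pow_succ']
    refine Finset.mul_mem_mul ?_ ha
    refine Finset.mem_insert_of_mem (Finset.mem_image.2 ⟨(i, 1), ?_, rfl⟩)
    simp [Q.one_mem]
    omega

lemma symm_bound {H : Type*} [Group H] (φ : H → H) (hφ : Function.Injective φ)
    (A P C : Set H) (hP : P.Finite) (hC : C.Finite) (hCn : C.Nonempty) (hAP : A ⊆ P)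
    (hAn : A.Nonempty) (δ : ℝ)
    (hc : (P.ncard : ℝ) ≤ (1 + δ) * A.ncard) (h : ∀ x ∈ A * C, φ x ∈ P * C) :
    ((symmDiff (φ '' (A * C)) (A * C)).ncard : ℝ) / ((A * C).ncard : ℝ) ≤ 2 * C.ncard * δ := by
  have hA := hP.subset hAP
  have hAC : (A * C).Finite := hA.mul hC
  have hPC : (P * C).Finite := hP.mul hC
  have h1 : A.ncard ≤ (A * C).ncard := by
    obtain ⟨c, hc⟩ := hCn
    rw [← Set.ncard_image_of_injective A (mul_left_injective c)]
    exact Set.ncard_le_ncard (by rintro _ ⟨a, ha, rfl⟩; exact Set.mul_mem_mul ha hc) hAC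
  have hA0 : 0 < A.ncard := (Set.ncard_pos hA).2 hAn
  have h2 : (φ '' (A * C) \ (A * C)).ncard ≤ (P \ A).ncard * C.ncard := by
    refine (Set.ncard_le_ncard (t := (P \ A) * C) ?_ ((hP.diff).mul hC)).trans ?_
    · rintro _ ⟨⟨x, hx, rfl⟩, hn⟩
      obtain ⟨p, hp, c, hc, hpc⟩ := h x hx
      refine ⟨p, ⟨hp, fun hpA => hn ?_⟩, c, hc, hpc⟩
      rw [← hpc]; exact Set.mul_mem_mul hpA hc
    · simp only [← Nat.card_coe_set_eq]
      exact Set.natCard_mul_le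
  have h3 : ((A * C) \ φ '' (A * C)).ncard = (φ '' (A * C) \ (A * C)).ncard := by
    refine (Set.ncard_eq_ncard_iff_ncard_diff_eq_ncard_diff hAC (hAC.image _)).1 ?_
    exact (Set.ncard_image_of_injective _ hφ).symm
  have h4 : (symmDiff (φ '' (A * C)) (A * C)).ncard ≤ 2 * ((P \ A).ncard * C.ncard) := by
    rw [Set.symmDiff_def]
    refine (Set.ncard_union_le _ _).trans ?_
    omega
  have h5 : ((P \ A).ncard : ℝ) + A.ncard = P.ncard := by
    exact_mod_cast Set.ncard_diff_add_ncard_of_subset hAP hP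
  have h1' : (A.ncard : ℝ) ≤ (A * C).ncard := by exact_mod_cast h1
  have hA0' : (0:ℝ) < A.ncard := by exact_mod_cast hA0
  have h4' : ((symmDiff (φ '' (A * C)) (A * C)).ncard : ℝ) ≤ 2 * (((P \ A).ncard : ℝ) * C.ncard) := by
    exact_mod_cast h4
  have hδ : ((P \ A).ncard : ℝ) ≤ δ * A.ncard := by linarith
  have hδ0 : 0 ≤ δ := by
    by_contra! hneg
    have : (0:ℝ) ≤ ((P \ A).ncard : ℝ) := by positivity
    nlinarith
  rw [div_le_iff₀ (by linarith)]
  calc _ ≤ _ := h4'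
    _ ≤ 2 * ((δ * (A * C).ncard) * C.ncard) := by
      gcongr
      exact hδ.trans (by gcongr)
    _ = _ := by ring

/-- Let `B ⊴ H` be a normal subgroup of a countable group `H` such
that the centralizer `C_H(B)` has finite index in `H`.  Then `[B : Z(B)] < ∞`, and
there are a set `C` of representatives for `B/Z(B)` and finite sets `Aₙ ⊆ Z(B)` such
that `Bₙ = Aₙ C ⊆ B` is a Følner sequence for `B` satisfying
`|g Bₙ g⁻¹ △ Bₙ| / |Bₙ| → 0` for every `g ∈ H`. -/
theorem stmt10 {H : Type*} [Group H] [Countable H] (B : Subgroup H) (hB : B.Normal)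
    (hfi : (Subgroup.centralizer (B : Set H)).FiniteIndex) :
    (Subgroup.center ↥B).FiniteIndex ∧
    ∃ C : Set H, C ⊆ (B : Set H) ∧
      (∀ b ∈ B, ∃ c ∈ C, b * c⁻¹ ∈ Subgroup.centralizer (B : Set H) ⊓ B) ∧
      (∀ c₁ ∈ C, ∀ c₂ ∈ C, c₁ * c₂⁻¹ ∈ Subgroup.centralizer (B : Set H) ⊓ B → c₁ = c₂) ∧
      ∃ Aseq : ℕ → Set H,
        (∀ n, Aseq n ⊆ ((Subgroup.centralizer (B : Set H) ⊓ B : Subgroup H) : Set H) ∧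
          (Aseq n).Finite ∧ (Aseq n).Nonempty) ∧
        (∀ b ∈ B, Tendsto
          (fun n => ((symmDiff ((b * ·) '' (Aseq n * C)) (Aseq n * C)).ncard : ℝ) /
            ((Aseq n * C).ncard : ℝ)) atTop (nhds 0)) ∧
        (∀ g : H, Tendsto
          (fun n => ((symmDiff ((fun x => g * x * g⁻¹) '' (Aseq n * C)) (Aseq n * C)).ncard : ℝ) /
            ((Aseq n * C).ncard : ℝ)) atTop (nhds 0)) := by
  classical
  haveI := hB
  haveI := hfi
  set K := Subgroup.centralizer (B : Set H) with hK
  haveI hKn : K.Normal := by rw [hK]; infer_instance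
  have hcomm : ∀ k ∈ K, ∀ b ∈ B, b * k = k * b := fun k hk b hb =>
    Subgroup.mem_centralizer_iff.1 hk b hb
  refine ⟨?_, ?_⟩
  · have : Subgroup.center ↥B = K.subgroupOf B := by
      ext x
      simp only [Subgroup.mem_center_iff, Subgroup.mem_subgroupOf, hK,
        Subgroup.mem_centralizer_iff, Subtype.forall, Subtype.ext_iff]
      rfl
    rw [this]
    infer_instance
  obtain ⟨C, hCB, hCbij⟩ := Set.exists_subset_bijOn (B : Set H) (QuotientGroup.mk : H → H ⧸ K)
  have hCfin : C.Finite := Set.Finite.of_finite_image (Set.toFinite _) hCbij.injOn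
  have hrep : ∀ b ∈ B, ∃ c ∈ C, b * c⁻¹ ∈ K ⊓ B := by
    intro b hb
    obtain ⟨c, hc, hbc⟩ := hCbij.surjOn (Set.mem_image_of_mem _ hb)
    refine ⟨c, hc, ?_, B.mul_mem hb (B.inv_mem (hCB hc))⟩
    have := QuotientGroup.eq_iff_div_mem.1 hbc.symm
    rwa [div_eq_mul_inv] at this
  have hCne : C.Nonempty := by
    obtain ⟨c, hc, -⟩ := hrep 1 B.one_mem
    exact ⟨c, hc⟩
  refine ⟨C, hCB, hrep, ?_, ?_⟩
  · intro c₁ h₁ c₂ h₂ h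
    refine hCbij.injOn h₁ h₂ (QuotientGroup.eq_iff_div_mem.2 ?_)
    rw [div_eq_mul_inv]; exact h.1
  let Z : Subgroup H := K ⊓ B
  letI : CommGroup ↥Z := { (inferInstance : Group ↥Z) with
    mul_comm := fun x y => Subtype.ext (hcomm y y.2.1 x x.2.2) }
  haveI hZn : Z.Normal := by infer_instance
  let ψ : H →* MulAut ↥Z := MulAut.conjNormal
  have hker : K ≤ ψ.ker := by
    intro k hk
    rw [MonoidHom.mem_ker]
    ext z
    simp only [ψ, MulAut.conjNormal_apply, MulAut.one_apply]
    rw [← hcomm k hk z z.2.2]; group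
  have hQ : (ψ.range : Set (MulAut ↥Z)).Finite := by
    haveI : ψ.ker.FiniteIndex := Subgroup.finiteIndex_of_le hker
    haveI : Finite (H ⧸ ψ.ker) := inferInstance
    exact Finite.of_equiv _ (QuotientGroup.quotientKerEquivRange ψ).toEquiv
  obtain ⟨A, P, hAne, hAP, hAinv, hAz, hcard⟩ := folner_aux ψ.range hQ
  have key : ∀ φ : H → H, Function.Injective φ →
      (∀ c ∈ C, ∃ z : ↥Z, ∃ c' ∈ C, ∀ n, ∀ a ∈ A n, ∃ a' ∈ A n,
        φ ((a : H) * c) = ((z * a' : ↥Z) : H) * c') →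
      Tendsto (fun n => ((symmDiff (φ '' ((Subtype.val '' (A n : Set ↥Z)) * C))
        ((Subtype.val '' (A n : Set ↥Z)) * C)).ncard : ℝ) /
            (((Subtype.val '' (A n : Set ↥Z)) * C).ncard : ℝ)) atTop (nhds 0) := by
    intro φ hφ h
    have hev : ∀ᶠ n in atTop, ∀ c ∈ C, ∀ a ∈ A n,
        φ ((a : H) * c) ∈ (Subtype.val '' (P n : Set ↥Z)) * C := by
      rw [Filter.eventually_all_finite hCfin]
      intro c hc
      obtain ⟨z, c', hc', hz⟩ := h c hc
      filter_upwards [hAz z] with n hn a ha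
      obtain ⟨a', ha', heq⟩ := hz n a ha
      rw [heq]
      exact Set.mul_mem_mul ⟨_, hn a' ha', rfl⟩ hc'
    have hlim : Tendsto (fun n : ℕ => 2 * (C.ncard : ℝ) * (1 / ((n : ℝ) + 1))) atTop (nhds 0) := by
      simpa using (tendsto_one_div_add_atTop_nhds_zero_nat (𝕜 := ℝ)).const_mul (2 * (C.ncard : ℝ))
    refine squeeze_zero' (Eventually.of_forall fun n => by positivity) ?_ hlim
    filter_upwards [hev] with n hn
    refine symm_bound φ hφ _ (Subtype.val '' (P n : Set ↥Z)) C ((P n).finite_toSet.image _) hCfin hCne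
      (Set.image_mono (by exact_mod_cast hAP n)) ((Finset.coe_nonempty.2 (hAne n)).image _) _ ?_ ?_
    · rw [Set.ncard_image_of_injective _ Subtype.val_injective,
        Set.ncard_image_of_injective _ Subtype.val_injective, Set.ncard_coe_finset,
        Set.ncard_coe_finset]
      exact hcard n
    · rintro _ ⟨_, ⟨a, ha, rfl⟩, c, hc, rfl⟩
      exact hn c hc a ha
  refine ⟨fun n => Subtype.val '' (A n : Set ↥Z), ?_, ?_, ?_⟩
  · intro n
    refine ⟨?_, (A n).finite_toSet.image _, (Finset.coe_nonempty.2 (hAne n)).image _⟩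
    rintro _ ⟨a, -, rfl⟩
    exact a.2
  · intro b hb
    refine key (b * ·) (mul_right_injective b) ?_
    intro c hc
    obtain ⟨c', hc', hz⟩ := hrep (b * c) (B.mul_mem hb (hCB hc))
    refine ⟨⟨_, hz⟩, c', hc', fun n a ha => ⟨a, ha, ?_⟩⟩
    have e1 := hcomm a a.2.1 b hb
    have e2 := hcomm a a.2.1 _ hz.2
    show b * ((a : H) * c) = (b * c * c'⁻¹ * (a : H)) * c'
    rw [e2, ← mul_assoc, e1]; group
  · intro g
    refine key (fun x => g * x * g⁻¹) (fun x y hxy => by simpa using hxy) ?_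
    intro c hc
    obtain ⟨c', hc', hz⟩ := hrep (g * c * g⁻¹) (hB.conj_mem _ (hCB hc) g)
    refine ⟨⟨_, hz⟩, c', hc', fun n a ha => ⟨ψ g a, hAinv n _ ⟨g, rfl⟩ a ha, ?_⟩⟩
    have e2 := hcomm _ (ψ g a).2.1 _ hz.2
    show g * ((a : H) * c) * g⁻¹ = (g * c * g⁻¹ * c'⁻¹ * (ψ g a : H)) * c'
    rw [e2]
    simp only [ψ, MulAut.conjNormal_apply]
    group
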